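/- arXiv:1804.06075 — 2 statements merged into one kernel-verified Lean document; each statement's English description precedes it below -/
import Mathlib

section
/- Combined difference-quotient integrals at fourth order: for real p₁, p₂ > 0 with p₁ ≠ p₂, set g₁(q) := log((1+p₁)/(1+q))/((1+q+p₁)²(p₁−q)), g₂(q) := log((1+q)/(1+p₂))/((1+q+p₂)²(q−p₂)) (removable singularities at q = p₁ resp. q = p₂ filled in by continuity) and c := log((1+p₁)/(1+p₂))/((1+p₁+p₂)²(p₁−p₂)). Then lim_{Λ→∞} [ ∫₀^Λ (g₂(q) − c)/(q−p₁) dq − ∫₀^Λ (g₁(q) − c)/(q−p₂) dq ] = (1/(1+p₁+p₂)) · [ log(1+p₂)/(p₂(1+2p₂)(1+p₂)) − log(1+p₁)/(p₁(1+2p₁)(1+p₁)) + (2+3p₁+p₂)(π²/6 − log²(1+p₁) − 2Li₂(−p₁))/((1+2p₁)²(1+p₁+p₂)) − (2+3p₂+p₁)(π²/6 − log²(1+p₂) − 2Li₂(−p₂))/((1+2p₂)²(1+p₁+p₂)) ], the removable singularities of the outer integrands at q = p₂ resp. q = p₁ being filled in by continuity. -/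
open MeasureTheory Real Filter

/-- The real dilogarithm, `Li₂(x) = −∫₀ˣ log(1−u)/u du`. -/
noncomputable def Li2 (x : ℝ) : ℝ := -∫ u in (0:ℝ)..x, Real.log (1 - u) / u

/-- `g₁(q) = log((1+p₁)/(1+q))/((1+q+p₁)²(p₁−q))` (removable singularity at `q = p₁`). -/
noncomputable def g₁ (p₁ : ℝ) (q : ℝ) : ℝ :=
  Real.log ((1 + p₁) / (1 + q)) / ((1 + q + p₁) ^ 2 * (p₁ - q))

/-- `g₂(q) = log((1+q)/(1+p₂))/((1+q+p₂)²(q−p₂))` (removable singularity at `q = p₂`). -/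
noncomputable def g₂ (p₂ : ℝ) (q : ℝ) : ℝ :=
  Real.log ((1 + q) / (1 + p₂)) / ((1 + q + p₂) ^ 2 * (q - p₂))

/-- `c = log((1+p₁)/(1+p₂))/((1+p₁+p₂)²(p₁−p₂))`. -/
noncomputable def cval (p₁ p₂ : ℝ) : ℝ :=
  Real.log ((1 + p₁) / (1 + p₂)) / ((1 + p₁ + p₂) ^ 2 * (p₁ - p₂))

/-- The continuous extension of `log (1+t)/t`. -/
noncomputable def phiQ (t : ℝ) : ℝ := dslope (fun x => Real.log (1 + x)) 0 t

lemma phiQ_of_ne {t : ℝ} (h : t ≠ 0) : phiQ t = Real.log (1 + t) / t := by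
  simp [phiQ, dslope_of_ne _ h, slope_def_field]

lemma phiQ_continuousAt {t : ℝ} (h : -1 < t) : ContinuousAt phiQ t := by
  have hd : DifferentiableAt ℝ (fun x : ℝ => Real.log (1 + x)) t := by
    refine DifferentiableAt.log (by fun_prop) (by linarith)
  by_cases h0 : t = 0
  · subst h0
    exact continuousAt_dslope_same.2 hd
  · exact (continuousAt_dslope_of_ne h0).2 hd.continuousAt

/-- `PQ y = ∫₀^y log(1+t)/t dt`. -/
noncomputable def PQ (y : ℝ) : ℝ := ∫ t in (0:ℝ)..y, phiQ t

lemma phiQ_intInt {a b : ℝ} (ha : -1 < a) (hb : -1 < b) :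
    IntervalIntegrable phiQ volume a b := by
  apply ContinuousOn.intervalIntegrable
  intro t ht
  apply (phiQ_continuousAt _).continuousWithinAt
  rcases ht with ⟨h1, _⟩
  exact lt_of_lt_of_le (lt_min ha hb) h1

lemma PQ_hasDerivAt {y : ℝ} (h : -1 < y) : HasDerivAt PQ (phiQ y) y := by
  apply intervalIntegral.integral_hasDerivAt_right (phiQ_intInt (by norm_num) h)
  · apply ContinuousOn.stronglyMeasurableAtFilter (s := Set.Ioi (-1)) isOpen_Ioi
    · intro t ht
      exact (phiQ_continuousAt ht).continuousWithinAt
    · exact h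
  · exact phiQ_continuousAt h

lemma ae_ne (c : ℝ) : ∀ᵐ x : ℝ, x ≠ c := by
  simp [ae_iff]

lemma PQ_eq (y : ℝ) : PQ y = ∫ t in (0:ℝ)..y, Real.log (1 + t) / t := by
  apply intervalIntegral.integral_congr_ae
  filter_upwards [ae_ne 0] with t ht _
  exact phiQ_of_ne ht

lemma Li2_eq (y : ℝ) : Li2 (-y) = - PQ y := by
  rw [Li2, PQ_eq]
  have := intervalIntegral.integral_comp_neg (a := 0) (b := y)
    (fun u : ℝ => Real.log (1 - u) / u)
  rw [intervalIntegral.integral_symm, neg_zero] at *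
  simp only [sub_neg_eq_add, div_neg, intervalIntegral.integral_neg] at this
  rw [neg_neg, ← this, intervalIntegral.integral_symm]
  simp

lemma const_of_deriv {f : ℝ → ℝ} {a b : ℝ} (h : ∀ x ∈ Set.uIcc a b, HasDerivAt f 0 x) :
    f b = f a := by
  have := intervalIntegral.integral_eq_sub_of_hasDerivAt (f := f) (f' := fun _ => 0) h (by simp)
  simp at this
  linarith

lemma PQ_zero : PQ 0 = 0 := by simp [PQ]

lemma sum_alt : HasSum (fun n : ℕ => (-1:ℝ) ^ n / ((n:ℝ) + 1) ^ 2) (π ^ 2 / 12) := by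
  have h := hasSum_one_div_nat_pow_mul_cos (k := 1) one_ne_zero (x := 1 / 2)
    ⟨by norm_num, by norm_num⟩
  rw [← hasSum_nat_add_iff' 1] at h
  have h2 := h.neg
  have hf : (fun n : ℕ => (-1:ℝ) ^ n / ((n:ℝ) + 1) ^ 2) = fun n : ℕ =>
      -(1 / (((n + 1 : ℕ) : ℝ)) ^ (2 * 1) * Real.cos (2 * π * ((n + 1 : ℕ) : ℝ) * (1 / 2))) := by
    ext n
    have : Real.cos (2 * π * ((n + 1 : ℕ) : ℝ) * (1 / 2)) = (-1) ^ (n + 1) := by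
      rw [← Real.cos_nat_mul_pi]
      congr 1
      ring
    rw [this]
    push_cast
    ring
  rw [hf]
  have hv : ∀ {u v : ℝ} {f : ℕ → ℝ}, HasSum f u → u = v → HasSum f v := fun h e => e ▸ h
  refine hv h2 ?_
  simp [Polynomial.bernoulli, Finset.sum_range_succ]
  norm_num [Nat.factorial, Nat.choose, bernoulli_two, bernoulli_one]
  ring

lemma PQ_one : PQ 1 = π ^ 2 / 12 := by
  rw [PQ_eq, intervalIntegral.integral_of_le zero_le_one]
  have hpowint : ∀ n : ℕ, ∫ t in Set.Ioc (0:ℝ) 1, t ^ n = 1 / ((n:ℝ) + 1) := by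
    intro n
    rw [← intervalIntegral.integral_of_le zero_le_one, integral_pow]
    simp
  have hF : ∀ n : ℕ, Integrable (fun t : ℝ => (-1:ℝ) ^ n / ((n:ℝ) + 1) * t ^ n)
      (volume.restrict (Set.Ioc (0:ℝ) 1)) := by
    intro n
    have : IntervalIntegrable (fun t : ℝ => (-1:ℝ) ^ n / ((n:ℝ) + 1) * t ^ n) volume 0 1 :=
      Continuous.intervalIntegrable (by fun_prop) _ _
    exact (intervalIntegrable_iff_integrableOn_Ioc_of_le zero_le_one).1 this
  have hnorm : ∀ n : ℕ, ∫ t in Set.Ioc (0:ℝ) 1, ‖(-1:ℝ) ^ n / ((n:ℝ) + 1) * t ^ n‖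
      = 1 / ((n:ℝ) + 1) ^ 2 := by
    intro n
    have : ∫ t in Set.Ioc (0:ℝ) 1, ‖(-1:ℝ) ^ n / ((n:ℝ) + 1) * t ^ n‖
        = ∫ t in Set.Ioc (0:ℝ) 1, 1 / ((n:ℝ) + 1) * t ^ n := by
      apply setIntegral_congr_fun measurableSet_Ioc
      intro t ht
      have h0 : (0:ℝ) < (n:ℝ) + 1 := by positivity
      simp only [norm_mul, norm_div, norm_pow, norm_neg, norm_one, one_pow, Real.norm_eq_abs,
        abs_of_pos h0, abs_of_pos ht.1]
    rw [this, integral_const_mul, hpowint]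
    field_simp
  have hs := hasSum_integral_of_summable_integral_norm hF (by
    simp only [hnorm]
    have := (summable_nat_add_iff 1).2 (Real.summable_one_div_nat_pow.2 one_lt_two)
    simpa using this)
  have hv : ∀ n : ℕ, ∫ t in Set.Ioc (0:ℝ) 1, (-1:ℝ) ^ n / ((n:ℝ) + 1) * t ^ n
      = (-1:ℝ) ^ n / ((n:ℝ) + 1) ^ 2 := by
    intro n
    rw [integral_const_mul, hpowint]
    field_simp
  simp only [hv] at hs
  rw [← hs.unique sum_alt]
  apply setIntegral_congr_ae measurableSet_Ioc
  filter_upwards [ae_ne 1] with t ht ht2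
  have hlt : t < 1 := lt_of_le_of_ne ht2.2 ht
  have h := Real.hasSum_pow_div_log_of_abs_lt_one (x := -t) (by
    rw [abs_neg, abs_of_pos ht2.1]; exact hlt)
  have h2 := (h.neg.div_const t)
  rw [sub_neg_eq_add, neg_neg] at h2
  rw [← h2.tsum_eq]
  apply tsum_congr
  intro n
  have h0 : t ≠ 0 := ht2.1.ne'
  rw [neg_pow]
  field_simp
  ring

lemma PQ_inv {y : ℝ} (hy : 0 < y) :
    PQ y = π ^ 2 / 6 + Real.log y ^ 2 / 2 - PQ y⁻¹ := by
  have key := const_of_deriv (f := fun y => PQ y + PQ y⁻¹ - Real.log y ^ 2 / 2) (a := 1) (b := y)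
    (by
      intro x hx
      have hx0 : 0 < x := lt_of_lt_of_le (lt_min one_pos hy) hx.1
      have hi : 0 < x⁻¹ := inv_pos.2 hx0
      have h1 := PQ_hasDerivAt (y := x) (by linarith)
      have h2 := (PQ_hasDerivAt (y := x⁻¹) (by linarith)).comp x (hasDerivAt_inv hx0.ne')
      have h3 := ((Real.hasDerivAt_log hx0.ne').pow 2).div_const 2
      refine ((h1.add h2).sub h3).congr_deriv ?_
      rw [phiQ_of_ne hx0.ne', phiQ_of_ne hi.ne']
      have : 1 + x⁻¹ = (1 + x) / x := by field_simp; ring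
      rw [this, Real.log_div (by linarith) hx0.ne']
      field_simp
      ring)
  simp [PQ_one] at key
  linarith

lemma PQ_landen {a : ℝ} (ha : 0 < a) :
    PQ (-a / (1 + a)) = - PQ a + Real.log (1 + a) ^ 2 / 2 := by
  have key := const_of_deriv
    (f := fun y => PQ (1 / (1 + y) - 1) + PQ y - Real.log (1 + y) ^ 2 / 2) (a := 0) (b := a)
    (by
      intro x hx
      have hx0 : 0 ≤ x := le_trans (le_min le_rfl ha.le) hx.1
      have hp : 0 < 1 + x := by linarith
      have hi : 0 < 1 / (1 + x) := by positivity
      have hl : HasDerivAt (fun y : ℝ => 1 + y) 1 x := (hasDerivAt_id x).const_add 1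
      have h1 := PQ_hasDerivAt (y := x) (by linarith)
      have hj : HasDerivAt (fun y : ℝ => 1 / (1 + y) - 1) (- 1 / (1 + x) ^ 2) x := by
        simpa using (hl.inv hp.ne').sub_const 1
      have h2 := (PQ_hasDerivAt (y := 1 / (1 + x) - 1) (by linarith)).comp x hj
      have h3 := ((hl.log hp.ne').pow 2).div_const 2
      refine ((h2.add h1).sub h3).congr_deriv ?_
      rcases hx0.eq_or_lt with h0 | h0
      · subst h0
        simp
      have e : 1 / (1 + x) - 1 = - x / (1 + x) := by field_simp; ring
      have hne : 1 / (1 + x) - 1 ≠ 0 := by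
        rw [e]; exact div_ne_zero (by linarith) hp.ne'
      rw [phiQ_of_ne h0.ne', phiQ_of_ne hne]
      have : 1 + (1 / (1 + x) - 1) = (1 + x)⁻¹ := by rw [one_div]; ring
      rw [this, Real.log_inv, e]
      field_simp
      ring)
  have e : 1 / (1 + a) - 1 = - a / (1 + a) := by field_simp; ring
  simp only [e] at key
  simp [PQ_zero] at key
  linarith

noncomputable def DQ (a q : ℝ) : ℝ := phiQ ((q - a) / (1 + a)) / (1 + a)
noncomputable def NQ (a q : ℝ) : ℝ := (Real.log (1 + q) - Real.log (1 + a)) / (1 + q + a)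
noncomputable def KQ (a q : ℝ) : ℝ := (Real.log (1 + q) - Real.log (1 + a)) / (1 + q + a) ^ 2

lemma DQ_of_ne {a q : ℝ} (ha : 0 < a) (hq : 0 ≤ q) (h : q ≠ a) :
    DQ a q = (Real.log (1 + q) - Real.log (1 + a)) / (q - a) := by
  have h1 : (0:ℝ) < 1 + a := by linarith
  have h2 : q - a ≠ 0 := sub_ne_zero.2 h
  have e : 1 + (q - a) / (1 + a) = (1 + q) / (1 + a) := by field_simp; ring
  rw [DQ, phiQ_of_ne (div_ne_zero h2 h1.ne'), e, Real.log_div (by linarith) h1.ne']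
  field_simp

lemma arg_gt {a q : ℝ} (ha : 0 < a) (hq : 0 ≤ q) : -1 < (q - a) / (1 + a) := by
  rw [lt_div_iff₀ (by linarith)]
  linarith

lemma DQ_cont {a q : ℝ} (ha : 0 < a) (hq : 0 ≤ q) : ContinuousAt (DQ a) q := by
  have h1 : ContinuousAt (fun q : ℝ => phiQ ((q - a) / (1 + a))) q :=
    ContinuousAt.comp (g := phiQ) (f := fun q : ℝ => (q - a) / (1 + a))
      (phiQ_continuousAt (arg_gt ha hq)) (by fun_prop)
  exact h1.div_const _

lemma log_cont {q : ℝ} (hq : 0 ≤ q) : ContinuousAt (fun q : ℝ => Real.log (1 + q)) q :=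
  ContinuousAt.log (by fun_prop) (by linarith)

lemma NQ_cont {a q : ℝ} (ha : 0 < a) (hq : 0 ≤ q) : ContinuousAt (NQ a) q :=
  ((log_cont hq).sub continuousAt_const).div (by fun_prop) (by linarith)

lemma KQ_cont {a q : ℝ} (ha : 0 < a) (hq : 0 ≤ q) : ContinuousAt (KQ a) q :=
  ((log_cont hq).sub continuousAt_const).div (by fun_prop) (by positivity)

/-- antiderivative of `DQ - NQ` -/
noncomputable def PhiQ (a q : ℝ) : ℝ :=
  PQ ((q - a) / (1 + a)) + PQ ((1 + q) / a)
    - Real.log (1 + q) * (Real.log (1 + q + a) - Real.log a)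
    + Real.log (1 + a) * Real.log (1 + q + a)

/-- antiderivative of `KQ` -/
noncomputable def PsiQ (a q : ℝ) : ℝ :=
  -((Real.log (1 + q) - Real.log (1 + a)) / (1 + q + a))
    + (Real.log (1 + q) - Real.log (1 + q + a)) / a

lemma PhiQ_deriv {a q : ℝ} (ha : 0 < a) (hq : 0 ≤ q) :
    HasDerivAt (PhiQ a) (DQ a q - NQ a q) q := by
  have hp : (0:ℝ) < 1 + q := by linarith
  have hpa : (0:ℝ) < 1 + q + a := by linarith
  have hy : 0 < (1 + q) / a := by positivity
  have hl : HasDerivAt (fun y : ℝ => 1 + y) 1 q := (hasDerivAt_id q).const_add 1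
  have hla : HasDerivAt (fun y : ℝ => 1 + y + a) 1 q := hl.add_const a
  have h1 := (PQ_hasDerivAt (arg_gt ha hq)).comp q
    (((hasDerivAt_id q).sub_const a).div_const (1 + a))
  have h2 := (PQ_hasDerivAt (y := (1 + q) / a) (by linarith)).comp q (hl.div_const a)
  have h3 := (hl.log hp.ne').mul ((hla.log hpa.ne').sub_const (Real.log a))
  have h4 := (hla.log hpa.ne').const_mul (Real.log (1 + a))
  refine (((h1.add h2).sub h3).add h4).congr_deriv ?_
  have e : 1 + (1 + q) / a = (1 + q + a) / a := by field_simp; ring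
  rw [phiQ_of_ne hy.ne', e, Real.log_div hpa.ne' ha.ne', DQ, NQ]
  field_simp
  ring

lemma PsiQ_deriv {a q : ℝ} (ha : 0 < a) (hq : 0 ≤ q) :
    HasDerivAt (PsiQ a) (KQ a q) q := by
  have hp : (0:ℝ) < 1 + q := by linarith
  have hpa : (0:ℝ) < 1 + q + a := by linarith
  have hl : HasDerivAt (fun y : ℝ => 1 + y) 1 q := (hasDerivAt_id q).const_add 1
  have hla : HasDerivAt (fun y : ℝ => 1 + y + a) 1 q := hl.add_const a
  have h1 := (((hl.log hp.ne').sub_const (Real.log (1 + a))).div hla hpa.ne').neg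
  have h2 := ((hl.log hp.ne').sub (hla.log hpa.ne')).div_const a
  refine (h1.add h2).congr_deriv ?_
  rw [KQ]
  field_simp
  ring

lemma tendsto_one_add : Tendsto (fun q : ℝ => 1 + q) atTop atTop :=
  tendsto_atTop_add_const_left _ _ tendsto_id

lemma log_div_tendsto : Tendsto (fun x : ℝ => Real.log x / x) atTop (nhds 0) :=
  Real.isLittleO_log_id_atTop.tendsto_div_nhds_zero

/-- `log(1+c/x) → 0` -/
lemma eps_tendsto (c : ℝ) : Tendsto (fun x : ℝ => Real.log (1 + c / x)) atTop (nhds 0) := by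
  have h : Tendsto (fun x : ℝ => 1 + c / x) atTop (nhds (1 + 0)) :=
    tendsto_const_nhds.add (tendsto_const_nhds.div_atTop tendsto_id)
  have := h.log (by norm_num)
  simpa using this

lemma eps_mul_tendsto (c : ℝ) :
    Tendsto (fun x : ℝ => Real.log x * Real.log (1 + c / x)) atTop (nhds 0) := by
  have h := (Real.tendsto_mul_log_one_add_div_atTop c).mul log_div_tendsto
  rw [mul_zero] at h
  refine h.congr' ?_
  filter_upwards [eventually_gt_atTop 0] with x hx
  field_simp

lemma PQ_inv_tendsto {f : ℝ → ℝ} (hf : Tendsto f atTop atTop) :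
    Tendsto (fun q => PQ (f q)⁻¹) atTop (nhds 0) := by
  have h := (PQ_hasDerivAt (y := 0) (by norm_num)).continuousAt.tendsto
  rw [PQ_zero] at h
  exact h.comp (tendsto_inv_atTop_zero.comp hf)

lemma PhiQ_tendsto {a : ℝ} (ha : 0 < a) :
    Tendsto (PhiQ a) atTop
      (nhds (π ^ 2 / 3 + Real.log (1 + a) ^ 2 / 2 + Real.log a ^ 2 / 2)) := by
  have h1a : (0:ℝ) < 1 + a := by linarith
  have t1 : Tendsto (fun q : ℝ => (q - a) / (1 + a)) atTop atTop :=
    (tendsto_atTop_add_const_right _ (-a) tendsto_id).atTop_div_const h1a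
  have t2 : Tendsto (fun q : ℝ => (1 + q) / a) atTop atTop :=
    tendsto_one_add.atTop_div_const ha
  have p1 := PQ_inv_tendsto t1
  have p2 := PQ_inv_tendsto t2
  have e1 := (eps_tendsto (-(1 + a))).comp tendsto_one_add
  have e2 := (eps_mul_tendsto (-(1 + a))).comp tendsto_one_add
  have d1 := (eps_tendsto a).comp tendsto_one_add
  have d2 := (eps_mul_tendsto a).comp tendsto_one_add
  have tot := ((((((tendsto_const_nhds (x := π ^ 2 / 3 + Real.log (1 + a) ^ 2 / 2
    + Real.log a ^ 2 / 2)).sub p1).sub p2).add e2).add ((e1.pow 2).div_const 2)).sub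
      (e1.const_mul (Real.log (1 + a)))).sub d2 |>.add (d1.const_mul (Real.log (1 + a)))
  have hv : ∀ {u v : ℝ} {f : ℝ → ℝ}, Tendsto f atTop (nhds u) → u = v →
    Tendsto f atTop (nhds v) := fun h e => e ▸ h
  refine (hv tot (by simp)).congr' ?_
  filter_upwards [eventually_gt_atTop a, eventually_gt_atTop 0] with q hqa hq
  have hp : (0:ℝ) < 1 + q := by linarith
  have hpa : (0:ℝ) < 1 + q + a := by linarith
  have hm : 0 < q - a := by linarith
  have E : 1 + -(1 + a) / (1 + q) = (q - a) / (1 + q) := by field_simp; ring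
  have D : 1 + a / (1 + q) = (1 + q + a) / (1 + q) := by field_simp
  simp only [Function.comp]
  rw [E, D, PhiQ, PQ_inv (y := (q - a) / (1 + a)) (by positivity),
    PQ_inv (y := (1 + q) / a) (by positivity)]
  rw [Real.log_div hm.ne' hp.ne', Real.log_div hpa.ne' hp.ne', Real.log_div hm.ne' h1a.ne',
    Real.log_div hp.ne' ha.ne']
  ring

lemma PhiQ_zero {a : ℝ} (ha : 0 < a) :
    PhiQ a 0 = -2 * PQ a + 3 * Real.log (1 + a) ^ 2 / 2 + π ^ 2 / 6 + Real.log a ^ 2 / 2 := by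
  have h := PQ_inv ha
  rw [PhiQ, zero_sub, PQ_landen ha]
  simp only [add_zero, Real.log_one, one_div]
  linarith

lemma PsiQ_tendsto {a : ℝ} (ha : 0 < a) : Tendsto (PsiQ a) atTop (nhds 0) := by
  have d1 := (eps_tendsto a).comp tendsto_one_add
  have l1 : Tendsto (fun q : ℝ => (1 + q) / (1 + q + a)) atTop (nhds 1) := by
    have h : Tendsto (fun q : ℝ => 1 - a / (1 + q + a)) atTop (nhds (1 - 0)) :=
      tendsto_const_nhds.sub (tendsto_const_nhds.div_atTop
        (tendsto_atTop_add_const_right _ a tendsto_one_add))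
    rw [sub_zero] at h
    refine h.congr' ?_
    filter_upwards [eventually_gt_atTop 0] with q hq
    have hpa : (0:ℝ) < 1 + q + a := by linarith
    field_simp
    ring
  have l2 := log_div_tendsto.comp tendsto_one_add
  have l3 : Tendsto (fun q : ℝ => Real.log (1 + a) / (1 + q + a)) atTop (nhds 0) :=
    tendsto_const_nhds.div_atTop (tendsto_atTop_add_const_right _ a tendsto_one_add)
  have tot := ((l2.mul l1).neg.add l3).sub (d1.div_const a)
  have hv : ∀ {u v : ℝ} {f : ℝ → ℝ}, Tendsto f atTop (nhds u) → u = v →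
    Tendsto f atTop (nhds v) := fun h e => e ▸ h
  refine (hv tot (by simp)).congr' ?_
  filter_upwards [eventually_gt_atTop 0] with q hq
  have hp : (0:ℝ) < 1 + q := by linarith
  have hpa : (0:ℝ) < 1 + q + a := by linarith
  have D : 1 + a / (1 + q) = (1 + q + a) / (1 + q) := by field_simp
  simp only [Function.comp]
  rw [D, PsiQ, Real.log_div hpa.ne' hp.ne']
  field_simp
  ring

lemma PsiQ_zero (a : ℝ) :
    PsiQ a 0 = Real.log (1 + a) / (1 + a) - Real.log (1 + a) / a := by
  simp [PsiQ]
  ring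

/-- regularised integrand, for `g₂` with `(a,b) = (p₁,p₂)`. -/
noncomputable def FQ (a b q : ℝ) : ℝ :=
  (1 / (a - b)) * (DQ a q / (1 + a + b) ^ 2 - DQ b q / (1 + 2 * b) ^ 2)
    + (2 + a + 3 * b) / ((1 + 2 * b) ^ 2 * (1 + a + b) ^ 2) * NQ b q
    + 1 / ((1 + 2 * b) * (1 + a + b)) * KQ b q

lemma FQ_cont {a b q : ℝ} (ha : 0 < a) (hb : 0 < b) (hq : 0 ≤ q) : ContinuousAt (FQ a b) q :=
  ((continuousAt_const.mul (((DQ_cont ha hq).div_const _).sub ((DQ_cont hb hq).div_const _))).add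
    (continuousAt_const.mul (NQ_cont hb hq))).add (continuousAt_const.mul (KQ_cont hb hq))

lemma FQ_eq {a b q : ℝ} (ha : 0 < a) (hb : 0 < b) (hab : a ≠ b) (hq : 0 ≤ q)
    (hqa : q ≠ a) (hqb : q ≠ b) :
    (g₂ b q - cval a b) / (q - a) = FQ a b q := by
  have h1 : q - a ≠ 0 := sub_ne_zero.2 hqa
  have h2 : q - b ≠ 0 := sub_ne_zero.2 hqb
  have h3 : a - b ≠ 0 := sub_ne_zero.2 hab
  have h4 : 1 + q + b ≠ 0 := by positivity
  have h5 : 1 + a + b ≠ 0 := by positivity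
  have h6 : 1 + 2 * b ≠ 0 := by positivity
  rw [FQ, DQ_of_ne ha hq hqa, DQ_of_ne hb hq hqb, NQ, KQ, g₂, cval,
    Real.log_div (by positivity) (by positivity), Real.log_div (by positivity) (by positivity)]
  generalize Real.log (1 + q) = x
  generalize Real.log (1 + a) = y
  generalize Real.log (1 + b) = z
  field_simp
  ring

lemma g₁_eq (a q : ℝ) (ha : 0 < a) (hq : 0 ≤ q) : g₁ a q = g₂ a q := by
  rw [g₁, g₂, Real.log_div (by positivity) (by positivity),
    Real.log_div (by positivity) (by positivity), ← neg_sub q a, mul_neg, div_neg, ← neg_div,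
    neg_sub]

lemma cval_symm {a b : ℝ} (ha : 0 < a) (hb : 0 < b) : cval a b = cval b a := by
  rw [cval, cval, Real.log_div (by positivity) (by positivity),
    Real.log_div (by positivity) (by positivity), ← neg_sub b a, mul_neg, div_neg, ← neg_div,
    neg_sub, add_right_comm]

lemma int_cont {f : ℝ → ℝ} (hf : ∀ q, 0 ≤ q → ContinuousAt f q) {Λ : ℝ} (hΛ : 0 ≤ Λ) :
    IntervalIntegrable f volume 0 Λ := by
  apply ContinuousOn.intervalIntegrable
  intro t ht
  rw [Set.uIcc_of_le hΛ] at ht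
  exact (hf t ht.1).continuousWithinAt

lemma FQ_diff {a b : ℝ} (ha : 0 < a) (hb : 0 < b) (hab : a ≠ b) (q : ℝ) :
    FQ a b q - FQ b a q =
      (2 + 3 * a + b) / ((1 + 2 * a) ^ 2 * (1 + a + b) ^ 2) * (DQ a q - NQ a q)
      - (2 + 3 * b + a) / ((1 + 2 * b) ^ 2 * (1 + a + b) ^ 2) * (DQ b q - NQ b q)
      + 1 / ((1 + 2 * b) * (1 + a + b)) * KQ b q
      - 1 / ((1 + 2 * a) * (1 + a + b)) * KQ a q := by
  have h3 : a - b ≠ 0 := sub_ne_zero.2 hab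
  have h3' : b - a = -(a - b) := by ring
  have h5 : 1 + a + b ≠ 0 := by positivity
  have h6 : 1 + 2 * b ≠ 0 := by positivity
  have h7 : 1 + 2 * a ≠ 0 := by positivity
  rw [FQ, FQ, add_right_comm 1 b a, h3']
  field_simp
  ring

/-- Combined difference-quotient integrals at fourth order. -/
theorem combined_difference_quotient_integrals (p₁ p₂ : ℝ) (hp₁ : 0 < p₁) (hp₂ : 0 < p₂)
    (hne : p₁ ≠ p₂) :
    Tendsto (fun Λ : ℝ =>
      (∫ q in (0:ℝ)..Λ, (g₂ p₂ q - cval p₁ p₂) / (q - p₁))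
        - ∫ q in (0:ℝ)..Λ, (g₁ p₁ q - cval p₁ p₂) / (q - p₂))
      atTop
      (nhds ((1 / (1 + p₁ + p₂)) *
        (Real.log (1 + p₂) / (p₂ * (1 + 2 * p₂) * (1 + p₂))
          - Real.log (1 + p₁) / (p₁ * (1 + 2 * p₁) * (1 + p₁))
          + (2 + 3 * p₁ + p₂) * (π ^ 2 / 6 - Real.log (1 + p₁) ^ 2 - 2 * Li2 (-p₁))
              / ((1 + 2 * p₁) ^ 2 * (1 + p₁ + p₂))
          - (2 + 3 * p₂ + p₁) * (π ^ 2 / 6 - Real.log (1 + p₂) ^ 2 - 2 * Li2 (-p₂))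
              / ((1 + 2 * p₂) ^ 2 * (1 + p₁ + p₂))))) := by
  have T := ((((PhiQ_tendsto hp₁).sub_const (PhiQ p₁ 0)).const_mul
      ((2 + 3 * p₁ + p₂) / ((1 + 2 * p₁) ^ 2 * (1 + p₁ + p₂) ^ 2))).sub
    (((PhiQ_tendsto hp₂).sub_const (PhiQ p₂ 0)).const_mul
      ((2 + 3 * p₂ + p₁) / ((1 + 2 * p₂) ^ 2 * (1 + p₁ + p₂) ^ 2)))).add
    (((PsiQ_tendsto hp₂).sub_const (PsiQ p₂ 0)).const_mul
      (1 / ((1 + 2 * p₂) * (1 + p₁ + p₂)))) |>.sub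
    (((PsiQ_tendsto hp₁).sub_const (PsiQ p₁ 0)).const_mul
      (1 / ((1 + 2 * p₁) * (1 + p₁ + p₂))))
  have hv : ∀ {u v : ℝ} {f : ℝ → ℝ}, Tendsto f atTop (nhds u) → u = v →
    Tendsto f atTop (nhds v) := fun h e => e ▸ h
  refine (hv T ?_).congr' ?_
  · rw [PhiQ_zero hp₁, PhiQ_zero hp₂, PsiQ_zero, PsiQ_zero, Li2_eq, Li2_eq]
    have h5 : 1 + p₁ + p₂ ≠ 0 := by positivity
    have h6 : 1 + 2 * p₂ ≠ 0 := by positivity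
    have h7 : 1 + 2 * p₁ ≠ 0 := by positivity
    have h8 : 1 + p₁ ≠ 0 := by positivity
    have h9 : 1 + p₂ ≠ 0 := by positivity
    generalize Real.log (1 + p₁) = y
    generalize Real.log (1 + p₂) = z
    field_simp
    ring
  · filter_upwards [eventually_ge_atTop 0] with Λ hΛ
    have i1 : (∫ q in (0:ℝ)..Λ, (g₂ p₂ q - cval p₁ p₂) / (q - p₁))
        = ∫ q in (0:ℝ)..Λ, FQ p₁ p₂ q := by
      apply intervalIntegral.integral_congr_ae
      filter_upwards [ae_ne p₁, ae_ne p₂] with q h1 h2 hq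
      rw [Set.uIoc_of_le hΛ] at hq
      exact FQ_eq hp₁ hp₂ hne hq.1.le h1 h2
    have i2 : (∫ q in (0:ℝ)..Λ, (g₁ p₁ q - cval p₁ p₂) / (q - p₂))
        = ∫ q in (0:ℝ)..Λ, FQ p₂ p₁ q := by
      apply intervalIntegral.integral_congr_ae
      filter_upwards [ae_ne p₁, ae_ne p₂] with q h1 h2 hq
      rw [Set.uIoc_of_le hΛ] at hq
      rw [g₁_eq p₁ q hp₁ hq.1.le, cval_symm hp₁ hp₂]
      exact FQ_eq hp₂ hp₁ hne.symm hq.1.le h2 h1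
    have c1 := int_cont (fun q hq => FQ_cont hp₁ hp₂ hq) hΛ
    have c2 := int_cont (fun q hq => FQ_cont hp₂ hp₁ hq) hΛ
    rw [i1, i2, ← intervalIntegral.integral_sub c1 c2]
    have F := intervalIntegral.integral_eq_sub_of_hasDerivAt
      (f := fun q => (2 + 3 * p₁ + p₂) / ((1 + 2 * p₁) ^ 2 * (1 + p₁ + p₂) ^ 2) * PhiQ p₁ q
        - (2 + 3 * p₂ + p₁) / ((1 + 2 * p₂) ^ 2 * (1 + p₁ + p₂) ^ 2) * PhiQ p₂ q
        + 1 / ((1 + 2 * p₂) * (1 + p₁ + p₂)) * PsiQ p₂ q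
        - 1 / ((1 + 2 * p₁) * (1 + p₁ + p₂)) * PsiQ p₁ q)
      (f' := fun q => FQ p₁ p₂ q - FQ p₂ p₁ q) (a := 0) (b := Λ)
      (by
        intro q hq
        rw [Set.uIcc_of_le hΛ] at hq
        rw [FQ_diff hp₁ hp₂ hne]
        exact ((((PhiQ_deriv hp₁ hq.1).const_mul _).sub
          ((PhiQ_deriv hp₂ hq.1).const_mul _)).add
          ((PsiQ_deriv hp₂ hq.1).const_mul _)).sub ((PsiQ_deriv hp₁ hq.1).const_mul _))
      (c1.sub c2)
    rw [F]
    ring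
end

section
/- Graph expansion reproduces the fourth-order 2-point function: for real p₁, p₂ > 0 with p₁ ≠ p₂, let I₁, I₂, I₃, I₄ denote the (convergent) double integrals over [0,∞)² in dq₁ dq₂ of, respectively, 1/((1+q₁+q₂)(1+p₁+q₁)(1+p₁+q₂)(1+p₂+q₁)(1+p₂+q₂)), 1/((1+p₁+q₁)(1+p₂+q₁)(1+p₁+q₂)(1+p₂+q₂)), 1/((1+q₁+q₂)(1+p₁+q₁)²(1+p₁+q₂)(1+p₂+q₁)), and 1/((1+q₁+q₂)(1+p₁+q₁)(1+p₂+q₁)²(1+p₂+q₂)). Then (2I₁ + 4I₃ + 4I₄)/(1+p₁+p₂)² + 4I₂/(1+p₁+p₂)³ = (2/((1+p₁+p₂)²(p₁−p₂))) · [ 3(log(1+p₁) − log(1+p₂))²/((1+p₁+p₂)(p₁−p₂)) + 2log(1+p₁)/(p₁(1+2p₁)(1+p₁)) − 2log(1+p₂)/(p₂(1+2p₂)(1+p₂)) − (1+2p₂)(π²/6 − 2Li₂(−p₁) − log²(1+p₁))/((1+2p₁)²(1+p₁+p₂)) + (1+2p₁)(π²/6 − 2Li₂(−p₂) − log²(1+p₂))/((1+2p₂)²(1+p₁+p₂))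 ]. -/
open MeasureTheory Real

/-- Double integral of the graph `Γ₁`. -/
noncomputable def I₁ (p₁ p₂ : ℝ) : ℝ :=
  ∫ q in (Set.Ici (0:ℝ) ×ˢ Set.Ici (0:ℝ)),
    1 / ((1 + q.1 + q.2) * (1 + p₁ + q.1) * (1 + p₁ + q.2) * (1 + p₂ + q.1) * (1 + p₂ + q.2))

/-- Double integral of the graph `Γ₂`. -/
noncomputable def I₂ (p₁ p₂ : ℝ) : ℝ :=
  ∫ q in (Set.Ici (0:ℝ) ×ˢ Set.Ici (0:ℝ)),
    1 / ((1 + p₁ + q.1) * (1 + p₂ + q.1) * (1 + p₁ + q.2) * (1 + p₂ + q.2))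

/-- Double integral of the graph `Γ₃`. -/
noncomputable def I₃ (p₁ p₂ : ℝ) : ℝ :=
  ∫ q in (Set.Ici (0:ℝ) ×ˢ Set.Ici (0:ℝ)),
    1 / ((1 + q.1 + q.2) * (1 + p₁ + q.1) ^ 2 * (1 + p₁ + q.2) * (1 + p₂ + q.1))

/-- Double integral of the graph `Γ₄`. -/
noncomputable def I₄ (p₁ p₂ : ℝ) : ℝ :=
  ∫ q in (Set.Ici (0:ℝ) ×ˢ Set.Ici (0:ℝ)),
    1 / ((1 + q.1 + q.2) * (1 + p₁ + q.1) * (1 + p₂ + q.1) ^ 2 * (1 + p₂ + q.2))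

open Set Filter Topology

/-- continuous extension of `-log(1-u)/u`. -/
noncomputable def hh : ℝ → ℝ := dslope (fun u : ℝ => -Real.log (1 - u)) 0

lemma hh_mul (x : ℝ) : x * hh x = -Real.log (1 - x) := by
  have := sub_smul_dslope (fun u : ℝ => -Real.log (1 - u)) 0 x
  simpa [hh] using this

lemma hh_ne {x : ℝ} (hx : x ≠ 0) : hh x = -(Real.log (1 - x) / x) := by
  have := hh_mul x
  field_simp
  linarith

lemma hh_cont {x : ℝ} (hx : x < 1) : ContinuousAt hh x := by
  have hd : ∀ y : ℝ, y < 1 → DifferentiableAt ℝ (fun u : ℝ => -Real.log (1 - u)) y := by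
    intro y hy
    have : (1 - y) ≠ 0 := by linarith
    fun_prop (disch := assumption)
  unfold hh
  by_cases h0 : x = 0
  · subst h0
    exact continuousAt_dslope_same.2 (hd 0 hx)
  · exact (continuousAt_dslope_of_ne h0).2 (hd x hx).continuousAt

lemma hh_nonneg {x : ℝ} (hx : x < 1) : 0 ≤ hh x := by
  by_cases h0 : x = 0
  · subst h0
    have : hh 0 = 1 := by
      have h : HasDerivAt (fun u : ℝ => -Real.log (1 - u)) 1 0 := by
        have := (((hasDerivAt_id (0:ℝ)).const_sub 1).log (by norm_num)).neg
        simpa using! this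
      rw [hh, dslope_same, h.deriv]
    rw [this]; norm_num
  · rw [hh_ne h0]
    rcases lt_or_gt_of_ne h0 with h | h
    · have : 0 ≤ Real.log (1 - x) := Real.log_nonneg (by linarith)
      have := div_nonpos_of_nonneg_of_nonpos this h.le
      linarith
    · have : Real.log (1 - x) ≤ 0 := Real.log_nonpos (by linarith) (by linarith)
      have := div_nonpos_of_nonpos_of_nonneg this h.le
      linarith

lemma Li2_eq_s14 (x : ℝ) : Li2 x = ∫ u in (0:ℝ)..x, hh u := by
  unfold Li2
  rw [← intervalIntegral.integral_neg]
  apply intervalIntegral.integral_congr_ae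
  have : ∀ᵐ u : ℝ, u ≠ 0 := compl_mem_ae_iff.2 (measure_singleton 0)
  filter_upwards [this] with u hu _
  exact (hh_ne hu).symm

lemma hh_contOn : ContinuousOn hh (Iio 1) := fun _ hx => (hh_cont hx).continuousWithinAt

lemma Li2_deriv {x : ℝ} (hx : x < 1) : HasDerivAt Li2 (hh x) x := by
  have e : Li2 = fun x => ∫ u in (0:ℝ)..x, hh u := funext Li2_eq_s14
  rw [e]
  refine intervalIntegral.integral_hasDerivAt_right ?_ ?_ (hh_cont hx)
  · apply ContinuousOn.intervalIntegrable
    apply hh_contOn.mono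
    intro y hy
    have := hy.2
    exact lt_of_le_of_lt this (max_lt (by norm_num) hx)
  · exact hh_contOn.stronglyMeasurableAtFilter isOpen_Iio x hx

lemma hh_int : IntervalIntegrable hh volume 0 1 := by
  apply IntervalIntegrable.trans (b := 1/2)
  · apply ContinuousOn.intervalIntegrable
    apply hh_contOn.mono
    intro y hy
    rw [uIcc_of_le (by norm_num)] at hy
    have := hy.2
    simp only [mem_Iio]; linarith
  · have h1 : IntervalIntegrable (fun u : ℝ => Real.log (1 - u)) volume (1/2) 1 := by
      have := (intervalIntegral.intervalIntegrable_log' (a := 1/2) (b := 0)).comp_sub_left 1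
      norm_num at this ⊢
      exact this
    have h2 := h1.mul_continuousOn (g := fun u : ℝ => -u⁻¹) (by
      apply ContinuousOn.neg
      apply ContinuousOn.inv₀ continuousOn_id
      intro y hy
      rw [uIcc_of_le (by norm_num)] at hy
      have := hy.1
      simp only [id]; intro h; rw [h] at this; norm_num at this)
    refine h2.congr ?_
    intro u hu
    rw [uIoc_of_le (by norm_num)] at hu
    have : u ≠ 0 := by have := hu.1; intro h; rw [h] at this; norm_num at this
    simp only [hh_ne this]
    ring

lemma Li2_one : Li2 1 = π ^ 2 / 6 := by
  rw [Li2_eq_s14, intervalIntegral.integral_of_le zero_le_one]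
  have hi : ∀ n : ℕ, ∫ u in Ioc (0:ℝ) 1, u ^ n / ((n:ℝ) + 1) = 1 / ((n + 1 : ℕ) : ℝ) ^ 2 := by
    intro n
    rw [← intervalIntegral.integral_of_le zero_le_one, intervalIntegral.integral_div, integral_pow]
    push_cast
    have : (n:ℝ) + 1 ≠ 0 := by positivity
    field_simp
    simp
  have hz : HasSum (fun n : ℕ => 1 / ((n + 1 : ℕ) : ℝ) ^ 2) (π ^ 2 / 6) := by
    have := (hasSum_nat_add_iff' (f := fun n : ℕ => (1 : ℝ) / (n : ℝ) ^ 2) 1).2 hasSum_zeta_two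
    simpa using this
  have key := hasSum_integral_of_summable_integral_norm
    (μ := volume.restrict (Ioc (0:ℝ) 1)) (F := fun (n : ℕ) (u : ℝ) => u ^ n / ((n:ℝ) + 1))
    (fun n => by
      have : IntervalIntegrable (fun u : ℝ => u ^ n / ((n:ℝ) + 1)) volume 0 1 :=
        Continuous.intervalIntegrable (by fun_prop) _ _
      exact (intervalIntegrable_iff_integrableOn_Ioc_of_le zero_le_one).1 this)
    (by
      refine hz.summable.congr ?_
      intro n
      rw [← hi]
      apply setIntegral_congr_fun measurableSet_Ioc
      intro u hu
      have := hu.1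
      simp only
      rw [Real.norm_of_nonneg (by positivity)])
  simp only [hi] at key
  rw [← key.unique hz]
  apply integral_congr_ae
  have h1 : ∀ᵐ u : ℝ ∂(volume.restrict (Ioc (0:ℝ) 1)), u ≠ 1 :=
    ae_restrict_of_ae (compl_mem_ae_iff.2 (measure_singleton 1))
  filter_upwards [h1, ae_restrict_mem measurableSet_Ioc] with u hu1 hu
  have hu0 : u ≠ 0 := hu.1.ne'
  have hlt : u < 1 := lt_of_le_of_ne hu.2 hu1
  have hs := Real.hasSum_pow_div_log_of_abs_lt_one (x := u) (by rw [abs_of_pos hu.1]; exact hlt)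
  have hs2 := hs.div_const u
  rw [hh_ne hu0]
  rw [← neg_div, ← hs2.tsum_eq]
  congr 1
  funext n
  field_simp
  ring

lemma Li2_tendsto : Tendsto Li2 (𝓝[≤] 1) (𝓝 (π ^ 2 / 6)) := by
  have e : Li2 = fun x => ∫ u in (0:ℝ)..x, hh u := funext Li2_eq_s14
  have h := intervalIntegral.continuousOn_primitive_interval' hh_int left_mem_uIcc
  rw [← e, uIcc_of_le zero_le_one] at h
  have h1 := (h 1 (by simp)).tendsto
  rw [Li2_one] at h1
  rwa [nhdsWithin_Icc_eq_nhdsLE zero_lt_one] at h1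

lemma inner_int {A B : ℝ} (hA : 0 < A) (hB : 0 < B) (hAB : A ≠ B) :
    IntegrableOn (fun y : ℝ => 1 / ((A + y) * (B + y))) (Ioi 0) ∧
    ∫ y in Ioi (0:ℝ), 1 / ((A + y) * (B + y)) = (Real.log A - Real.log B) / (A - B) := by
  have hs : A - B ≠ 0 := sub_ne_zero.2 hAB
  have hd : ∀ y ∈ Ici (0:ℝ), HasDerivAt
      (fun y => (Real.log (B + y) - Real.log (A + y)) / (A - B)) (1 / ((A + y) * (B + y))) y := by
    intro y hy
    have hy : 0 ≤ y := hy
    have h1 : B + y ≠ 0 := by positivity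
    have h2 : A + y ≠ 0 := by positivity
    refine HasDerivAt.congr_deriv (((((hasDerivAt_id y).const_add B).log h1).sub
      (((hasDerivAt_id y).const_add A).log h2)).div_const (A - B)) ?_
    simp only [id]
    field_simp
    ring
  have hp : ∀ y ∈ Ioi (0:ℝ), 0 ≤ 1 / ((A + y) * (B + y)) := by
    intro y hy
    have hy : 0 < y := hy
    positivity
  have ht : Tendsto (fun y => (Real.log (B + y) - Real.log (A + y)) / (A - B)) atTop (𝓝 0) := by
    have h1 : Tendsto (fun y : ℝ => (A - B) / (B + y)) atTop (𝓝 0) :=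
      tendsto_const_nhds.div_atTop (tendsto_atTop_add_const_left _ _ tendsto_id)
    have h2 : Tendsto (fun y : ℝ => -Real.log (1 + (A - B) / (B + y)) / (A - B)) atTop (𝓝 0) := by
      have := (((h1.const_add 1).log (by norm_num)).neg).div_const (A - B)
      simpa using this
    refine h2.congr' ?_
    filter_upwards [eventually_ge_atTop 0] with y hy
    have e : 1 + (A - B) / (B + y) = (A + y) / (B + y) := by
      have h1 : B + y ≠ 0 := by positivity
      field_simp; ring
    rw [e, Real.log_div (by positivity) (by positivity)]
    ring
  refine ⟨integrableOn_Ioi_deriv_of_nonneg' hd hp ht, ?_⟩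
  rw [integral_Ioi_of_hasDerivAt_of_nonneg' hd hp ht]
  simp only [add_zero]
  ring

lemma quad_measure : (volume : Measure (ℝ × ℝ)).restrict (Ici (0:ℝ) ×ˢ Ici (0:ℝ))
    = (volume.restrict (Ioi (0:ℝ))).prod (volume.restrict (Ioi (0:ℝ))) := by
  rw [Measure.volume_eq_prod, ← Measure.prod_restrict,
    Measure.restrict_congr_set (Ioi_ae_eq_Ici (μ := volume) (a := (0:ℝ)))]

lemma master {b l : ℝ} (hb : 0 < b) (w P : ℝ → ℝ) (hw : Measurable w)
    (hw0 : ∀ q, 0 < q → 0 ≤ w q)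
    (hd : ∀ q ∈ Ici (0:ℝ), HasDerivAt P (w q * (hh ((q - b) / (1 + q)) / (1 + q))) q)
    (ht : Tendsto P atTop (𝓝 l)) :
    IntegrableOn (fun q : ℝ × ℝ => w q.1 * (1 / ((1 + q.1 + q.2) * (1 + b + q.2))))
      (Ici (0:ℝ) ×ˢ Ici (0:ℝ)) ∧
    ∫ q in Ici (0:ℝ) ×ˢ Ici (0:ℝ), w q.1 * (1 / ((1 + q.1 + q.2) * (1 + b + q.2))) = l - P 0 := by
  have hp : ∀ q ∈ Ioi (0:ℝ), 0 ≤ w q * (hh ((q - b) / (1 + q)) / (1 + q)) := by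
    intro q hq
    have hq : 0 < q := hq
    have : (q - b) / (1 + q) < 1 := by rw [div_lt_one (by positivity)]; linarith
    have := hh_nonneg this
    have := hw0 q hq
    positivity
  have hI := integrableOn_Ioi_deriv_of_nonneg' hd hp ht
  have hE := integral_Ioi_of_hasDerivAt_of_nonneg' hd hp ht
  have hae : ∀ᵐ q : ℝ ∂(volume.restrict (Ioi (0:ℝ))), q ≠ b :=
    ae_restrict_of_ae (compl_mem_ae_iff.2 (measure_singleton b))
  have hin : ∀ᵐ q : ℝ ∂(volume.restrict (Ioi (0:ℝ))),
      IntegrableOn (fun y => w q * (1 / ((1 + q + y) * (1 + b + y)))) (Ioi 0) ∧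
      ∫ y in Ioi (0:ℝ), w q * (1 / ((1 + q + y) * (1 + b + y)))
        = w q * (hh ((q - b) / (1 + q)) / (1 + q)) := by
    filter_upwards [hae, ae_restrict_mem measurableSet_Ioi] with q hqb hq
    have hq : 0 < q := hq
    obtain ⟨h1, h2⟩ := inner_int (A := 1 + q) (B := 1 + b) (by positivity) (by positivity)
      (by intro h; apply hqb; linarith)
    refine ⟨h1.const_mul _, ?_⟩
    rw [integral_const_mul, h2]
    have hs : q - b ≠ 0 := sub_ne_zero.2 hqb
    have hv : (q - b) / (1 + q) ≠ 0 := div_ne_zero hs (by positivity)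
    have e : 1 - (q - b) / (1 + q) = (1 + b) / (1 + q) := by field_simp; ring
    rw [hh_ne hv, e, Real.log_div (by positivity) (by positivity)]
    have e2 : 1 + q - (1 + b) = q - b := by ring
    rw [e2]
    field_simp
    ring
  have hm : Measurable (fun q : ℝ × ℝ => w q.1 * (1 / ((1 + q.1 + q.2) * (1 + b + q.2)))) := by
    fun_prop
  have hint : IntegrableOn (fun q : ℝ × ℝ => w q.1 * (1 / ((1 + q.1 + q.2) * (1 + b + q.2))))
      (Ici (0:ℝ) ×ˢ Ici (0:ℝ)) := by
    unfold IntegrableOn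
    rw [quad_measure, integrable_prod_iff hm.aestronglyMeasurable]
    refine ⟨hin.mono fun q h => h.1, ?_⟩
    refine Integrable.congr hI ?_
    filter_upwards [hin, ae_restrict_mem measurableSet_Ioi] with q h hq
    rw [← h.2]
    apply setIntegral_congr_fun measurableSet_Ioi
    intro y hy
    have hy : 0 < y := hy
    have hq : 0 < q := hq
    have := hw0 q hq
    simp only
    rw [Real.norm_of_nonneg (by positivity)]
  refine ⟨hint, ?_⟩
  unfold IntegrableOn at hint
  rw [quad_measure] at hint ⊢
  rw [integral_prod _ hint, ← hE]
  apply integral_congr_ae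
  filter_upwards [hin] with q h
  exact h.2

lemma ell_eq {b q : ℝ} (hb : 0 < b) (hq : 0 ≤ q) :
    Real.log (1 + q) - Real.log (1 + b) = (q - b) / (1 + q) * hh ((q - b) / (1 + q)) := by
  have e : 1 - (q - b) / (1 + q) = (1 + b) / (1 + q) := by field_simp; ring
  rw [hh_mul, e, Real.log_div (by positivity) (by positivity)]
  ring

lemma log_eq {a q : ℝ} : Real.log (1 + a / (1 + q)) = a / (1 + q) * hh (-(a / (1 + q))) := by
  have := hh_mul (-(a / (1 + q)))
  rw [sub_neg_eq_add] at this
  linarith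

/-- Primitive of the one-dimensional integrand. -/
noncomputable def QQ (a b q : ℝ) : ℝ :=
  Li2 ((q - b) / (1 + q)) + Li2 (-(a / (1 + q)))
    - (Real.log (1 + q) - Real.log (1 + b)) * Real.log (1 + a / (1 + q))

lemma ell_deriv (b : ℝ) {q : ℝ} (hq : 0 ≤ q) :
    HasDerivAt (fun q => Real.log (1 + q) - Real.log (1 + b)) (1 / (1 + q)) q := by
  have h1 : (1 + q) ≠ 0 := by positivity
  exact (((hasDerivAt_id q).const_add 1).log h1).sub_const _

lemma as_deriv (a : ℝ) {q : ℝ} (hq : 0 ≤ q) :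
    HasDerivAt (fun q => a / (1 + q)) (-(a / (1 + q) ^ 2)) q := by
  have h1 : (1 + q) ≠ 0 := by positivity
  have := (hasDerivAt_const q a).div ((hasDerivAt_id q).const_add 1) h1
  refine this.congr_deriv ?_
  simp [neg_div]

lemma logas_deriv {a q : ℝ} (ha : 0 < a) (hq : 0 ≤ q) :
    HasDerivAt (fun q => Real.log (1 + a / (1 + q))) (-(a / ((1 + q) * (1 + a + q)))) q := by
  have h1 : 1 + a / (1 + q) ≠ 0 := by positivity
  refine HasDerivAt.congr_deriv (((as_deriv a hq).const_add 1).log h1) ?_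
  field_simp
  ring

lemma QQ_deriv {a b q : ℝ} (ha : 0 < a) (hb : 0 < b) (hq : 0 ≤ q) :
    HasDerivAt (QQ a b)
      ((1 + a + b) * (1 / (1 + a + q) * (hh ((q - b) / (1 + q)) / (1 + q)))) q := by
  have hv : HasDerivAt (fun q => (q - b) / (1 + q)) ((1 + b) / (1 + q) ^ 2) q := by
    have h1 : (1 + q) ≠ 0 := by positivity
    refine HasDerivAt.congr_deriv (((hasDerivAt_id q).sub_const b).div ((hasDerivAt_id q).const_add 1) h1) ?_
    simp only [id]
    ring
  have hv1 : (q - b) / (1 + q) < 1 := by rw [div_lt_one (by positivity)]; linarith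
  have hu1 : -(a / (1 + q)) < 1 := by
    have : 0 < a / (1 + q) := by positivity
    linarith
  have d1 := (Li2_deriv hv1).comp q hv
  have d2 := (Li2_deriv hu1).comp q (as_deriv a hq).neg
  have d3 := (ell_deriv b hq).mul (logas_deriv ha hq)
  refine HasDerivAt.congr_deriv ((d1.add d2).sub d3) ?_
  rw [ell_eq hb hq, log_eq]
  have : 1 + a + q ≠ 0 := by positivity
  field_simp
  ring

lemma inv_tendsto (a : ℝ) : Tendsto (fun q : ℝ => a / (1 + q)) atTop (𝓝 0) :=
  tendsto_const_nhds.div_atTop (tendsto_atTop_add_const_left _ _ tendsto_id)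

lemma ell_div_tendsto (b : ℝ) :
    Tendsto (fun q : ℝ => (Real.log (1 + q) - Real.log (1 + b)) / (1 + q)) atTop (𝓝 0) := by
  have h1 : Tendsto (fun q : ℝ => Real.log (1 + q) / (1 + q)) atTop (𝓝 0) := by
    have := (Real.isLittleO_log_id_atTop.tendsto_div_nhds_zero).comp
      (tendsto_atTop_add_const_left atTop (1:ℝ) tendsto_id)
    exact this
  have := h1.sub (inv_tendsto (Real.log (1 + b)))
  simp only [sub_zero] at this
  refine this.congr fun q => ?_
  ring

lemma logas_tendsto (a : ℝ) : Tendsto (fun q : ℝ => Real.log (1 + a / (1 + q))) atTop (𝓝 0) := by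
  have := ((inv_tendsto a).const_add 1).log (by norm_num)
  simpa using this

lemma QQ_tendsto {a b : ℝ} (ha : 0 < a) (hb : 0 < b) :
    Tendsto (QQ a b) atTop (𝓝 (π ^ 2 / 6)) := by
  have t1 : Tendsto (fun q => Li2 ((q - b) / (1 + q))) atTop (𝓝 (π ^ 2 / 6)) := by
    refine Li2_tendsto.comp ?_
    refine tendsto_nhdsWithin_iff.2 ⟨?_, ?_⟩
    · have := (inv_tendsto (1 + b)).const_sub 1
      simp only [sub_zero] at this
      refine this.congr' ?_
      filter_upwards [eventually_ge_atTop 0] with q hq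
      field_simp
      ring
    · filter_upwards [eventually_ge_atTop 0] with q hq
      simp only [mem_Iic]
      rw [div_le_one (by positivity)]; linarith
  have t2 : Tendsto (fun q => Li2 (-(a / (1 + q)))) atTop (𝓝 0) := by
    have hc := (Li2_deriv (x := 0) (by norm_num)).continuousAt.tendsto
    have h0 : Li2 0 = 0 := by simp [Li2]
    rw [h0] at hc
    refine hc.comp ?_
    simpa using (inv_tendsto a).neg
  have t3 : Tendsto (fun q => (Real.log (1 + q) - Real.log (1 + b)) * Real.log (1 + a / (1 + q)))
      atTop (𝓝 0) := by
    have t := (ell_div_tendsto b).mul_const a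
    rw [zero_mul] at t
    refine squeeze_zero' ?_ ?_ t
    · filter_upwards [eventually_ge_atTop b] with q hq
      have h0 : 0 < q := hb.trans_le hq
      apply mul_nonneg
      · exact sub_nonneg.2 (Real.log_le_log (by positivity) (by linarith))
      · apply Real.log_nonneg
        have : 0 < a / (1 + q) := by positivity
        linarith
    · filter_upwards [eventually_ge_atTop b] with q hq
      have h0 : 0 < q := hb.trans_le hq
      have h1 : 0 ≤ Real.log (1 + q) - Real.log (1 + b) :=
        sub_nonneg.2 (Real.log_le_log (by positivity) (by linarith))
      have h2 : Real.log (1 + a / (1 + q)) ≤ a / (1 + q) := by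
        have := Real.log_le_sub_one_of_pos (x := 1 + a / (1 + q)) (by positivity)
        linarith
      calc _ ≤ (Real.log (1 + q) - Real.log (1 + b)) * (a / (1 + q)) :=
            mul_le_mul_of_nonneg_left h2 h1
        _ = _ := by ring
  have := (t1.add t2).sub t3
  rw [add_zero, sub_zero] at this
  exact this

lemma K_int {a b : ℝ} (ha : 0 < a) (hb : 0 < b) :
    IntegrableOn (fun q : ℝ × ℝ => 1 / (1 + a + q.1) * (1 / ((1 + q.1 + q.2) * (1 + b + q.2))))
      (Ici (0:ℝ) ×ˢ Ici (0:ℝ)) ∧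
    ∫ q in Ici (0:ℝ) ×ˢ Ici (0:ℝ), 1 / (1 + a + q.1) * (1 / ((1 + q.1 + q.2) * (1 + b + q.2)))
      = (π ^ 2 / 6 - Li2 (-a) - Li2 (-b) - Real.log (1 + a) * Real.log (1 + b)) / (1 + a + b) := by
  have hc : 1 + a + b ≠ 0 := by positivity
  have := master (l := π ^ 2 / 6 / (1 + a + b)) hb (fun q => 1 / (1 + a + q))
    (fun q => QQ a b q / (1 + a + b)) (by fun_prop) (fun q hq => by positivity)
    (fun q hq => by
      refine HasDerivAt.congr_deriv ((QQ_deriv ha hb hq).div_const (1 + a + b)) ?_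
      field_simp)
    ((QQ_tendsto ha hb).div_const _)
  refine ⟨this.1, ?_⟩
  rw [this.2]
  simp [QQ]
  field_simp
  ring

lemma M_int {a : ℝ} (ha : 0 < a) :
    IntegrableOn (fun q : ℝ × ℝ => 1 / (1 + a + q.1) ^ 2 *
      (1 / ((1 + q.1 + q.2) * (1 + a + q.2)))) (Ici (0:ℝ) ×ˢ Ici (0:ℝ)) ∧
    ∫ q in Ici (0:ℝ) ×ˢ Ici (0:ℝ), 1 / (1 + a + q.1) ^ 2 *
      (1 / ((1 + q.1 + q.2) * (1 + a + q.2)))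
      = (π ^ 2 / 6 - 2 * Li2 (-a) - Real.log (1 + a) ^ 2) / (1 + 2 * a) ^ 2
        - Real.log (1 + a) / (a * (1 + a) * (1 + 2 * a)) := by
  have hc : 1 + a + a ≠ 0 := by positivity
  have hc2 : 1 + 2 * a ≠ 0 := by positivity
  have ht : Tendsto (fun q => (QQ a a q / (1 + a + a)
      + (Real.log (1 + q) - Real.log (1 + a)) / (1 + a + q)
      + Real.log (1 + a / (1 + q)) / a) / (1 + a + a)) atTop
      (𝓝 ((π ^ 2 / 6 / (1 + a + a) + 0 + 0 / a) / (1 + a + a))) := by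
    refine ((((QQ_tendsto ha ha).div_const _).add ?_).add
      ((logas_tendsto a).div_const _)).div_const _
    refine squeeze_zero' ?_ ?_ (ell_div_tendsto a)
    all_goals
      filter_upwards [eventually_ge_atTop a] with q hq
      have h0 : 0 < q := ha.trans_le hq
      have h1 : 0 ≤ Real.log (1 + q) - Real.log (1 + a) :=
        sub_nonneg.2 (Real.log_le_log (by positivity) (by linarith))
    · positivity
    · apply div_le_div_of_nonneg_left h1 (by positivity) (by linarith)
  have := master ha (fun q => 1 / (1 + a + q) ^ 2) _ (by fun_prop) (fun q hq => by positivity)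
    (fun q hq => by
      have hq : 0 ≤ q := hq
      have hx : 1 + a + q ≠ 0 := by positivity
      have d2 := (ell_deriv a hq).div ((hasDerivAt_id q).const_add (1 + a)) hx
      have d3 := (logas_deriv ha hq).div_const a
      refine HasDerivAt.congr_deriv (((((QQ_deriv ha ha hq).div_const (1 + a + a)).add d2).add d3).div_const (1 + a + a)) ?_
      simp only [id]
      rw [ell_eq ha hq]
      field_simp
      ring) ht
  refine ⟨this.1, ?_⟩
  rw [this.2]
  simp [QQ]
  field_simp
  ring

lemma comb4 {μ : Measure (ℝ × ℝ)} {f g h k : ℝ × ℝ → ℝ} (hf : Integrable f μ)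
    (hg : Integrable g μ) (hh : Integrable h μ) (hk : Integrable k μ) :
    ∫ q, f q ∂μ - ∫ q, g q ∂μ - ∫ q, h q ∂μ + ∫ q, k q ∂μ = ∫ q, (f q - g q - h q + k q) ∂μ := by
  have h1 : Integrable (fun q => f q - g q) μ := hf.sub hg
  have h2 : Integrable (fun q => f q - g q - h q) μ := h1.sub hh
  rw [integral_add h2 hk, integral_sub h1 hh, integral_sub hf hg]

lemma comb3 {μ : Measure (ℝ × ℝ)} {f g h : ℝ × ℝ → ℝ} (c d : ℝ) (hf : Integrable f μ)
    (hg : Integrable g μ) (hh : Integrable h μ) :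
    (∫ q, f q ∂μ) / c - (∫ q, g q ∂μ - ∫ q, h q ∂μ) / d
      = ∫ q, (f q / c - (g q - h q) / d) ∂μ := by
  have h1 : Integrable (fun q => g q - h q) μ := hg.sub hh
  rw [integral_sub (hf.div_const c) (h1.div_const d), integral_div, integral_div,
    integral_sub hg hh]

lemma I₂_eq {a b : ℝ} (ha : 0 < a) (hb : 0 < b) (hab : a ≠ b) :
    I₂ a b = ((Real.log (1 + a) - Real.log (1 + b)) / (a - b)) ^ 2 := by
  obtain ⟨-, h⟩ := inner_int (A := 1 + a) (B := 1 + b) (by positivity) (by positivity)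
    (by intro h; apply hab; linarith)
  have e : I₂ a b = ∫ q in Ici (0:ℝ) ×ˢ Ici (0:ℝ),
      (fun y : ℝ => 1 / ((1 + a + y) * (1 + b + y))) q.1 *
      (fun y : ℝ => 1 / ((1 + a + y) * (1 + b + y))) q.2 := by
    unfold I₂
    congr 1
    funext q
    simp only
    rw [div_mul_div_comm, one_mul]
    congr 1
    ring
  rw [e, quad_measure, integral_prod_mul (fun y : ℝ => 1 / ((1 + a + y) * (1 + b + y)))
    (fun y : ℝ => 1 / ((1 + a + y) * (1 + b + y))), h]
  have e2 : 1 + a - (1 + b) = a - b := by ring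
  rw [e2]
  ring

lemma I₁_eq {a b : ℝ} (ha : 0 < a) (hb : 0 < b) (hab : a ≠ b) :
    I₁ a b = ((π ^ 2 / 6 - Li2 (-a) - Li2 (-a) - Real.log (1 + a) * Real.log (1 + a)) / (1 + a + a)
      - (π ^ 2 / 6 - Li2 (-a) - Li2 (-b) - Real.log (1 + a) * Real.log (1 + b)) / (1 + a + b)
      - (π ^ 2 / 6 - Li2 (-b) - Li2 (-a) - Real.log (1 + b) * Real.log (1 + a)) / (1 + b + a)
      + (π ^ 2 / 6 - Li2 (-b) - Li2 (-b) - Real.log (1 + b) * Real.log (1 + b)) / (1 + b + b))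
      / (a - b) ^ 2 := by
  have hs : a - b ≠ 0 := sub_ne_zero.2 hab
  rw [← (K_int ha ha).2, ← (K_int ha hb).2, ← (K_int hb ha).2, ← (K_int hb hb).2,
    comb4 (K_int ha ha).1 (K_int ha hb).1 (K_int hb ha).1 (K_int hb hb).1, ← integral_div]
  unfold I₁
  apply setIntegral_congr_fun (measurableSet_Ici.prod measurableSet_Ici)
  rintro ⟨x, y⟩ ⟨hx, hy⟩
  simp only [mem_Ici] at hx hy
  have h1 : 1 + x + y ≠ 0 := by positivity
  have h2 : 1 + a + x ≠ 0 := by positivity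
  have h3 : 1 + b + x ≠ 0 := by positivity
  have h4 : 1 + a + y ≠ 0 := by positivity
  have h5 : 1 + b + y ≠ 0 := by positivity
  simp only
  field_simp
  ring

lemma I₃_eq {a b : ℝ} (ha : 0 < a) (hb : 0 < b) (hab : a ≠ b) :
    I₃ a b = ((π ^ 2 / 6 - 2 * Li2 (-a) - Real.log (1 + a) ^ 2) / (1 + 2 * a) ^ 2
        - Real.log (1 + a) / (a * (1 + a) * (1 + 2 * a))) / (b - a)
      - ((π ^ 2 / 6 - Li2 (-a) - Li2 (-a) - Real.log (1 + a) * Real.log (1 + a)) / (1 + a + a)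
      - (π ^ 2 / 6 - Li2 (-b) - Li2 (-a) - Real.log (1 + b) * Real.log (1 + a)) / (1 + b + a))
      / (b - a) ^ 2 := by
  have hs : b - a ≠ 0 := sub_ne_zero.2 hab.symm
  rw [← (M_int ha).2, ← (K_int ha ha).2, ← (K_int hb ha).2,
    comb3 _ _ (M_int ha).1 (K_int ha ha).1 (K_int hb ha).1]
  unfold I₃
  apply setIntegral_congr_fun (measurableSet_Ici.prod measurableSet_Ici)
  rintro ⟨x, y⟩ ⟨hx, hy⟩
  simp only [mem_Ici] at hx hy
  have h1 : 1 + x + y ≠ 0 := by positivity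
  have h2 : 1 + a + x ≠ 0 := by positivity
  have h3 : 1 + b + x ≠ 0 := by positivity
  have h4 : 1 + a + y ≠ 0 := by positivity
  simp only
  field_simp
  ring

lemma I₄_eq (a b : ℝ) : I₄ a b = I₃ b a := by
  unfold I₃ I₄
  congr 1
  funext q
  congr 1
  ring

/-- Graph expansion reproduces the fourth-order 2-point function. -/
theorem graph_expansion_fourth_order (p₁ p₂ : ℝ) (hp₁ : 0 < p₁) (hp₂ : 0 < p₂) (hne : p₁ ≠ p₂) :
    (2 * I₁ p₁ p₂ + 4 * I₃ p₁ p₂ + 4 * I₄ p₁ p₂) / (1 + p₁ + p₂) ^ 2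
        + 4 * I₂ p₁ p₂ / (1 + p₁ + p₂) ^ 3
      = (2 / ((1 + p₁ + p₂) ^ 2 * (p₁ - p₂))) *
        (3 * (Real.log (1 + p₁) - Real.log (1 + p₂)) ^ 2 / ((1 + p₁ + p₂) * (p₁ - p₂))
          + 2 * Real.log (1 + p₁) / (p₁ * (1 + 2 * p₁) * (1 + p₁))
          - 2 * Real.log (1 + p₂) / (p₂ * (1 + 2 * p₂) * (1 + p₂))
          - (1 + 2 * p₂) * (π ^ 2 / 6 - 2 * Li2 (-p₁) - Real.log (1 + p₁) ^ 2)
              / ((1 + 2 * p₁) ^ 2 * (1 + p₁ + p₂))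
          + (1 + 2 * p₁) * (π ^ 2 / 6 - 2 * Li2 (-p₂) - Real.log (1 + p₂) ^ 2)
              / ((1 + 2 * p₂) ^ 2 * (1 + p₁ + p₂))) := by
  have hs : p₁ - p₂ ≠ 0 := sub_ne_zero.2 hne
  have hs' : p₂ - p₁ ≠ 0 := sub_ne_zero.2 hne.symm
  rw [I₄_eq, I₁_eq hp₁ hp₂ hne, I₂_eq hp₁ hp₂ hne, I₃_eq hp₁ hp₂ hne, I₃_eq hp₂ hp₁ hne.symm]
  generalize Li2 (-p₁) = A
  generalize Li2 (-p₂) = B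
  generalize Real.log (1 + p₁) = L
  generalize Real.log (1 + p₂) = N
  generalize π ^ 2 / 6 = Z
  have e1 : p₂ - p₁ = -(p₁ - p₂) := by ring
  have e2 : 1 + p₂ + p₁ = 1 + p₁ + p₂ := by ring
  have e3 : 1 + p₁ + p₁ = 1 + 2 * p₁ := by ring
  have e4 : 1 + p₂ + p₂ = 1 + 2 * p₂ := by ring
  rw [e1, e2, e3, e4]
  obtain ⟨d, hd⟩ : ∃ d, d = p₁ - p₂ := ⟨_, rfl⟩
  have h1 : 1 + 2 * p₁ ≠ 0 := by positivity
  have h2 : 1 + 2 * p₂ ≠ 0 := by positivity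
  have h3 : 1 + p₁ + p₂ ≠ 0 := by positivity
  have h4 : 1 + p₁ ≠ 0 := by positivity
  have h5 : 1 + p₂ ≠ 0 := by positivity
  field_simp
  ring
end
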